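/- The third cohomology group H³(S₃, ℂ*) of the symmetric group S₃ with trivial coefficients in ℂ* is cyclic of order 6. -/

import Mathlib

namespace SymmetricThree

open CategoryTheory

/-- The symmetric group on three letters. -/
abbrev G : Type := Equiv.Perm (Fin 3)

/-- The transposition of the first two letters. -/
def s : G := Equiv.swap 0 1

/-- The transposition of the last two letters. -/
def t : G := Equiv.swap 1 2

/-- The three-cycle `s * t`. -/
def u : G := Equiv.swap 0 1 * Equiv.swap 1 2

/-- The three-cycle `t * s`. -/
def v : G := Equiv.swap 1 2 * Equiv.swap 0 1

/-- The longest element `s * t * s`. -/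
def w : G := Equiv.swap 0 2

lemma mul_table : s * s = 1 ∧ s * t = u ∧ s * u = t ∧ s * v = w ∧ t * s = v ∧ t * t = 1 ∧
    t * u = w ∧ t * v = s ∧ u * s = w ∧ u * t = s ∧ u * u = v ∧ u * v = 1 ∧ v * s = t ∧
    v * t = w ∧ v * u = 1 ∧ v * v = u ∧ w * s = u ∧ w * t = v ∧ w * u = s ∧ w * v = t := by
  decide

lemma univ_eq : (Finset.univ : Finset G) = {1, s, t, u, v, w} := by decide

lemma forall_iff {p : G → Prop} :
    (∀ g, p g) ↔ p 1 ∧ p s ∧ p t ∧ p u ∧ p v ∧ p w := by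
  have h : (∀ g, p g) ↔ ∀ g ∈ (Finset.univ : Finset G), p g := by simp
  rw [h, univ_eq]
  simp

lemma sum_eq {M : Type*} [AddCommMonoid M] (f : G → M) :
    ∑ g, f g = f 1 + (f s + (f t + (f u + (f v + f w)))) := by
  rw [univ_eq]
  repeat rw [Finset.sum_insert (by decide)]
  rw [Finset.sum_singleton]

/-- The function on `S₃` with the given values at `1, s, t, u, v, w`. -/
def ofVals (a b c d e f : ℤ) (g : G) : ℤ :=
  if g = 1 then a else if g = s then b else if g = t then c else
    if g = u then d else if g = v then e else f

lemma ofVals_apply (a b c d e f : ℤ) :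
    ofVals a b c d e f 1 = a ∧ ofVals a b c d e f s = b ∧ ofVals a b c d e f t = c ∧
    ofVals a b c d e f u = d ∧ ofVals a b c d e f v = e ∧ ofVals a b c d e f w = f :=
  ⟨rfl, rfl, rfl, rfl, rfl, rfl⟩

lemma exact_zero (x : G → ℤ) (h : ∑ g, x g = 0) :
    ∃ y z : G → ℤ, ∀ g, y (g * s) - y g + z (g * t) - z g = x g := by
  refine ⟨ofVals (-x 1 - x t - x v) 0 (x v) (-x 1 - x s - x t - x u - x v) 0 0,
    ofVals (x t + x v) (-x 1 - x s - x t - x v) 0 0 0 0, ?_⟩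
  simp only [sum_eq, forall_iff, one_mul, mul_table, ofVals_apply] at h ⊢
  omega

lemma exact_one (x y : G → ℤ) (h : ∀ g, x (g * s) - x g + y (g * t) - y g = 0) :
    ∃ a b : G → ℤ, (∀ g, a g + a (g * s) + b g + b (g * v) - b (g * t) = x g) ∧
      ∀ g, b (g * s) - b g - b (g * u) = y g := by
  refine ⟨ofVals (x 1 + y v) 0 (x t + y s) (x u + y 1) 0 0,
    ofVals (-x 1 + x s - y 1 - y v) (-y s - y v) (-x 1 + x s - y 1) (x 1 - x s - y s) 0 0, ?_⟩
  simp only [forall_iff, one_mul, mul_table, ofVals_apply] at h ⊢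
  omega

lemma exact_two (x y : G → ℤ) (h : ∀ g, x g + x (g * s) + y g + y (g * v) - y (g * t) = 0)
    (h' : ∀ g, y (g * s) - y g - y (g * u) = 0) :
    ∃ a : G → ℤ, (∀ g, a g - a (g * s) = x g) ∧
      ∀ g, a (g * s) - a (g * t) + a (g * v) - a (g * u) = y g := by
  refine ⟨ofVals (x 1 + x t + x u + y 1) (x t + x u + y 1) (x 1 + x t + y 1 - y s) (x u)
    (x 1 + y 1 - y s) 0, ?_⟩
  simp only [forall_iff, one_mul, mul_table, ofVals_apply] at h h' ⊢
  omega

lemma exact_three (x : G → ℤ) (h : ∀ g, x g - x (g * s) = 0)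
    (h' : ∀ g, x (g * s) - x (g * t) + x (g * v) - x (g * u) = 0) (g : G) : x g = x 1 := by
  revert g
  simp only [forall_iff, one_mul, mul_table, true_and] at h h' ⊢
  omega

lemma exact_of_forall {k Γ : Type} [CommRing k] [Group Γ] (S : ShortComplex (Rep.{0} k Γ))
    (h : ∀ x, S.g.hom x = 0 → ∃ y, S.f.hom y = x) : S.Exact := by
  apply (forget₂ (Rep.{0} k Γ) (ModuleCat k)).reflects_exact_of_faithful
  rw [ShortComplex.moduleCat_exact_iff]
  exact h

section Free

variable (k Γ : Type) [CommRing k] [Group Γ] (r : ℕ)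

/-- The regular action of a group on `r`-tuples of functions. -/
def freeRepresentation : Representation k Γ (Fin r → Γ → k) where
  toFun g :=
    { toFun := fun x i h => x i (g⁻¹ * h)
      map_add' := fun _ _ => rfl
      map_smul' := fun _ _ => rfl }
  map_one' := by ext; simp
  map_mul' _ _ := by ext; simp [mul_assoc]

/-- The free module of rank `r` over the group ring of a finite group, as a module of functions. -/
abbrev freeRep : Rep k Γ := Rep.of (freeRepresentation k Γ r)

variable {k Γ r}

lemma freeRepresentation_apply (g : Γ) (x : Fin r → Γ → k) (i : Fin r) (h : Γ) :
    freeRepresentation k Γ r g x i h = x i (g⁻¹ * h) := rfl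

lemma hom_ext_apply {A : Rep k Γ} {f f' : freeRep k Γ r ⟶ A}
    (h : ∀ x : Fin r → Γ → k, f.hom x = f'.hom x) : f = f' :=
  Rep.hom_ext (DFunLike.ext _ _ h)

variable [DecidableEq Γ]

/-- The basis elements of `freeRep k Γ r`. -/
def basis (i : Fin r) : Fin r → Γ → k := Pi.single i (Pi.single 1 1)

variable [Fintype Γ]

lemma eq_sum_basis (x : Fin r → Γ → k) :
    x = ∑ i, ∑ g, x i g • freeRepresentation k Γ r g (basis i) := by
  ext j h
  simp only [Finset.sum_apply, Pi.smul_apply, freeRepresentation_apply, basis]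
  rw [Finset.sum_eq_single j, Finset.sum_eq_single h]
  · simp
  · intro b _ hb
    rw [Pi.single_eq_same, Pi.single_eq_of_ne, smul_zero]
    simpa [inv_mul_eq_one] using hb
  · simp
  · intro b _ hb
    simp [Pi.single_eq_of_ne hb.symm]
  · simp

lemma hom_apply_eq_sum {A : Rep k Γ} (f : freeRep k Γ r ⟶ A) (x : Fin r → Γ → k) :
    f.hom x = ∑ i, ∑ g, x i g • A.ρ g (f.hom (basis i)) := by
  conv_lhs => rw [eq_sum_basis x]
  simp only [map_sum, map_smul]
  refine Finset.sum_congr rfl fun i _ => Finset.sum_congr rfl fun g _ => ?_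
  rw [← Rep.hom_comm_apply]

lemma hom_ext_basis {A : Rep k Γ} {f f' : freeRep k Γ r ⟶ A}
    (h : ∀ i, f.hom (basis i) = f'.hom (basis i)) : f = f' :=
  hom_ext_apply fun x => by simp only [hom_apply_eq_sum _ x, h]

/-- The morphism out of `freeRep k Γ r` with prescribed values on the basis. -/
def lift {A : Rep.{0} k Γ} (c : Fin r → A) : freeRep k Γ r ⟶ A :=
  Rep.ofHom (LinearMap.intertwiningMap_of_isIntertwiningMap (freeRepresentation k Γ r) A.ρ
    { toFun := fun x => ∑ i, ∑ g, x i g • A.ρ g (c i)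
      map_add' := fun x y => by simp [add_smul, Finset.sum_add_distrib]
      map_smul' := fun m x => by simp [mul_smul, Finset.smul_sum] }
    fun g x => by
      simp only [LinearMap.coe_mk, AddHom.coe_mk, map_sum, map_smul]
      refine Finset.sum_congr rfl fun i _ => ?_
      refine (Fintype.sum_equiv (Equiv.mulLeft g) _ _ fun h => ?_).symm
      simp [freeRepresentation_apply])

omit [DecidableEq Γ] in
lemma lift_apply {A : Rep.{0} k Γ} (c : Fin r → A) (x : Fin r → Γ → k) :
    (lift c).hom x = ∑ i, ∑ g, x i g • A.ρ g (c i) := rfl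

lemma lift_basis {A : Rep.{0} k Γ} (c : Fin r → A) (i : Fin r) :
    (lift c).hom (basis i) = c i := by
  rw [lift_apply, Finset.sum_eq_single i, Finset.sum_eq_single 1]
  · simp [basis]
  · intro b _ hb
    simp [basis, Pi.single_eq_of_ne hb]
  · simp
  · intro b _ hb
    simp [basis, Pi.single_eq_of_ne hb]
  · simp

instance : Projective (freeRep k Γ r) where
  factors {E X} f e _ := by
    have he := (Rep.epi_iff_surjective e).1 inferInstance
    choose c hc using fun i => he (f.hom (basis i))
    refine ⟨lift c, hom_ext_basis fun i => ?_⟩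
    rw [← hc i, Rep.hom_comp, ← lift_basis c i]
    rfl

end Free

/-- The differential in degrees `4n + 1`, as a linear map. -/
def dOne : (Fin 2 → G → ℤ) →ₗ[ℤ] (Fin 1 → G → ℤ) where
  toFun x _ g := x 0 (g * s) - x 0 g + x 1 (g * t) - x 1 g
  map_add' x y := by ext; simp; ring
  map_smul' m x := by ext; simp; ring

/-- The differential in degrees `4n + 2`, as a linear map. -/
def dTwo : (Fin 2 → G → ℤ) →ₗ[ℤ] (Fin 2 → G → ℤ) where
  toFun x := ![fun g => x 0 g + x 0 (g * s) + x 1 g + x 1 (g * v) - x 1 (g * t),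
    fun g => x 1 (g * s) - x 1 g - x 1 (g * u)]
  map_add' x y := by ext i; fin_cases i <;> simp <;> ring
  map_smul' m x := by ext i; fin_cases i <;> simp <;> ring

/-- The differential in degrees `4n + 3`, as a linear map. -/
def dThree : (Fin 1 → G → ℤ) →ₗ[ℤ] (Fin 2 → G → ℤ) where
  toFun x := ![fun g => x 0 g - x 0 (g * s),
    fun g => x 0 (g * s) - x 0 (g * t) + x 0 (g * v) - x 0 (g * u)]
  map_add' x y := by ext i; fin_cases i <;> simp <;> ring
  map_smul' m x := by ext i; fin_cases i <;> simp <;> ring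

/-- The differential in degrees `4n + 4`, given by the norm element, as a linear map. -/
def dFour : (Fin 1 → G → ℤ) →ₗ[ℤ] (Fin 1 → G → ℤ) where
  toFun x _ _ := ∑ h, x 0 h
  map_add' x y := by ext; simp [Finset.sum_add_distrib]
  map_smul' m x := by ext; simp [Finset.mul_sum]

lemma dOne_apply (x : Fin 2 → G → ℤ) (i : Fin 1) (g : G) :
    dOne x i g = x 0 (g * s) - x 0 g + x 1 (g * t) - x 1 g := rfl

lemma dTwo_apply_zero (x : Fin 2 → G → ℤ) (g : G) :
    dTwo x 0 g = x 0 g + x 0 (g * s) + x 1 g + x 1 (g * v) - x 1 (g * t) := rfl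

lemma dTwo_apply_one (x : Fin 2 → G → ℤ) (g : G) :
    dTwo x 1 g = x 1 (g * s) - x 1 g - x 1 (g * u) := rfl

lemma dThree_apply_zero (x : Fin 1 → G → ℤ) (g : G) :
    dThree x 0 g = x 0 g - x 0 (g * s) := rfl

lemma dThree_apply_one (x : Fin 1 → G → ℤ) (g : G) :
    dThree x 1 g = x 0 (g * s) - x 0 (g * t) + x 0 (g * v) - x 0 (g * u) := rfl

lemma dFour_apply (x : Fin 1 → G → ℤ) (i : Fin 1) (g : G) : dFour x i g = ∑ h, x 0 h := rfl

lemma dOne_equivariant (g : G) (x : Fin 2 → G → ℤ) :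
    dOne (freeRepresentation ℤ G 2 g x) = freeRepresentation ℤ G 1 g (dOne x) := by
  ext
  simp [dOne_apply, freeRepresentation_apply, mul_assoc]

lemma dTwo_equivariant (g : G) (x : Fin 2 → G → ℤ) :
    dTwo (freeRepresentation ℤ G 2 g x) = freeRepresentation ℤ G 2 g (dTwo x) := by
  refine funext fun i => funext fun g => ?_
  revert i
  simp [Fin.forall_fin_two, dTwo_apply_zero, dTwo_apply_one, freeRepresentation_apply, mul_assoc]

lemma dThree_equivariant (g : G) (x : Fin 1 → G → ℤ) :
    dThree (freeRepresentation ℤ G 1 g x) = freeRepresentation ℤ G 2 g (dThree x) := by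
  refine funext fun i => funext fun g => ?_
  revert i
  simp [Fin.forall_fin_two, dThree_apply_zero, dThree_apply_one, freeRepresentation_apply,
    mul_assoc]

lemma dFour_equivariant (g : G) (x : Fin 1 → G → ℤ) :
    dFour (freeRepresentation ℤ G 1 g x) = freeRepresentation ℤ G 1 g (dFour x) :=
  funext fun _ => funext fun _ => Fintype.sum_equiv (Equiv.mulLeft g⁻¹) _ _ fun _ => rfl

lemma sum_dOne (x : Fin 2 → G → ℤ) : ∑ g, dOne x 0 g = 0 := by
  simp only [dOne_apply, sum_eq, one_mul, mul_table]
  ring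

lemma dOne_dTwo (x : Fin 2 → G → ℤ) : dOne (dTwo x) = 0 := by
  funext i g
  simp only [dOne_apply, dTwo_apply_zero, dTwo_apply_one, mul_assoc, mul_table, mul_one,
    Pi.zero_apply]
  ring

lemma dTwo_dThree (x : Fin 1 → G → ℤ) : dTwo (dThree x) = 0 := by
  refine funext fun i => funext fun g => ?_
  revert i
  simp only [Fin.forall_fin_two, dTwo_apply_zero, dTwo_apply_one, dThree_apply_zero,
    dThree_apply_one, mul_assoc, mul_table, mul_one, Pi.zero_apply]
  constructor <;> ring

lemma dThree_dFour (x : Fin 1 → G → ℤ) : dThree (dFour x) = 0 := by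
  refine funext fun i => funext fun g => ?_
  revert i
  simp [Fin.forall_fin_two, dThree_apply_zero, dThree_apply_one, dFour_apply]

lemma dFour_dOne (x : Fin 2 → G → ℤ) : dFour (dOne x) = 0 :=
  funext fun _ => funext fun _ => sum_dOne x

lemma exists_dOne_eq (x : Fin 1 → G → ℤ) (h : ∑ g, x 0 g = 0) : ∃ y, dOne y = x := by
  obtain ⟨a, b, hab⟩ := exact_zero (x 0) h
  refine ⟨![a, b], ?_⟩
  funext i g
  fin_cases i
  exact hab g

lemma exists_dTwo_eq (x : Fin 2 → G → ℤ) (h : dOne x = 0) : ∃ y, dTwo y = x := by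
  obtain ⟨a, b, ha, hb⟩ := exact_one (x 0) (x 1) fun g => congr_fun (congr_fun h 0) g
  refine ⟨![a, b], ?_⟩
  funext i g
  fin_cases i
  exacts [ha g, hb g]

lemma exists_dThree_eq (x : Fin 2 → G → ℤ) (h : dTwo x = 0) : ∃ y, dThree y = x := by
  obtain ⟨a, ha, hb⟩ := exact_two (x 0) (x 1) (fun g => congr_fun (congr_fun h 0) g)
    fun g => congr_fun (congr_fun h 1) g
  refine ⟨![a], ?_⟩
  funext i g
  fin_cases i
  exacts [ha g, hb g]

lemma exists_dFour_eq (x : Fin 1 → G → ℤ) (h : dThree x = 0) : ∃ y, dFour y = x := by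
  have hx := exact_three (x 0) (fun g => congr_fun (congr_fun h 0) g)
    fun g => congr_fun (congr_fun h 1) g
  refine ⟨fun _ => Pi.single 1 (x 0 1), ?_⟩
  funext i g
  fin_cases i
  refine (dFour_apply _ 0 g).trans ?_
  simpa using (hx g).symm

/-- The morphism of free modules given by an equivariant linear map. -/
abbrev mkHom {r r' : ℕ} (f : (Fin r → G → ℤ) →ₗ[ℤ] (Fin r' → G → ℤ))
    (hf : ∀ g x, f (freeRepresentation ℤ G r g x) = freeRepresentation ℤ G r' g (f x)) :
    freeRep ℤ G r ⟶ freeRep ℤ G r' :=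
  Rep.ofHom (LinearMap.intertwiningMap_of_isIntertwiningMap _ _ f hf)

/-- The ranks of the terms of the periodic resolution. -/
def rank : ℕ → ℕ
  | 0 => 1
  | 1 => 2
  | 2 => 2
  | 3 => 1
  | n + 4 => rank n

/-- The differentials of the periodic resolution. -/
def d : ∀ n, freeRep ℤ G (rank (n + 1)) ⟶ freeRep ℤ G (rank n)
  | 0 => mkHom dOne dOne_equivariant
  | 1 => mkHom dTwo dTwo_equivariant
  | 2 => mkHom dThree dThree_equivariant
  | 3 => mkHom dFour dFour_equivariant
  | n + 4 => d n

lemma d_comp_d : ∀ n, d (n + 1) ≫ d n = 0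
  | 0 => hom_ext_apply dOne_dTwo
  | 1 => hom_ext_apply dTwo_dThree
  | 2 => hom_ext_apply dThree_dFour
  | 3 => hom_ext_apply dFour_dOne
  | n + 4 => d_comp_d n

lemma d_exact : ∀ n (x : Fin (rank (n + 1)) → G → ℤ), (d n).hom x = 0 → ∃ y, (d (n + 1)).hom y = x
  | 0 => exists_dTwo_eq
  | 1 => exists_dThree_eq
  | 2 => exists_dFour_eq
  | 3 => fun x h => exists_dOne_eq x (congr_fun (congr_fun h (0 : Fin 1)) 1)
  | n + 4 => d_exact n

/-- The periodic complex of free `ℤ[S₃]`-modules. -/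
noncomputable def complex : ChainComplex (Rep ℤ G) ℕ :=
  ChainComplex.of (fun n => freeRep ℤ G (rank n)) d d_comp_d

lemma complex_d (n : ℕ) : complex.d (n + 1) n = d n :=
  ChainComplex.of_d (fun n => freeRep ℤ G (rank n)) d n

/-- The augmentation, summing the values of a function. -/
def augmentation : freeRep ℤ G 1 ⟶ Rep.trivial ℤ G ℤ :=
  lift (A := Rep.trivial ℤ G ℤ) fun _ => (1 : ℤ)

lemma augmentation_apply (x : Fin 1 → G → ℤ) : augmentation.hom x = ∑ g, x 0 g := by
  refine (lift_apply (A := Rep.trivial ℤ G ℤ) _ x).trans ?_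
  simp

lemma d_comp_augmentation : d 0 ≫ augmentation = 0 :=
  hom_ext_apply fun x => (augmentation_apply _).trans (sum_dOne x)

/-- The augmentation as a map of complexes. -/
noncomputable def π : complex ⟶ (ChainComplex.single₀ (Rep ℤ G)).obj (Rep.trivial ℤ G ℤ) :=
  (complex.toSingle₀Equiv _).symm ⟨augmentation, by rw [complex_d]; exact d_comp_augmentation⟩

lemma π_f_zero : π.f 0 = augmentation :=
  ChainComplex.toSingle₀Equiv_symm_apply_f_zero _ _

lemma quasiIso_π : QuasiIso π where
  quasiIsoAt m := by
    cases m with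
    | zero =>
      rw [ChainComplex.quasiIsoAt₀_iff, ShortComplex.quasiIso_iff_of_zeros' _ rfl rfl rfl]
      constructor
      · refine exact_of_forall _ ?_
        intro (x : Fin 1 → G → ℤ) hx
        change (π.f 0).hom x = 0 at hx
        rw [π_f_zero] at hx
        change ∃ y, (complex.d 1 0).hom y = x
        rw [complex_d]
        exact exists_dOne_eq x ((augmentation_apply x).symm.trans hx)
      · change Epi (π.f 0)
        rw [Rep.epi_iff_surjective, π_f_zero]
        intro (x : ℤ)
        exact ⟨fun _ => Pi.single 1 x, (augmentation_apply _).trans (by simp)⟩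
    | succ m =>
      rw [quasiIsoAt_iff_exactAt' (hL := ChainComplex.exactAt_succ_single_obj ..),
        HomologicalComplex.exactAt_iff' _ (m + 2) (m + 1) m (by simp) (by simp)]
      refine exact_of_forall _ ?_
      intro (x : Fin (rank (m + 1)) → G → ℤ) hx
      change (complex.d (m + 1) m).hom x = 0 at hx
      change ∃ y, (complex.d (m + 1 + 1) (m + 1)).hom y = x
      rw [complex_d] at hx ⊢
      exact d_exact m x hx

/-- The periodic free resolution of the trivial representation of `S₃`. -/
noncomputable def resolution : ProjectiveResolution (Rep.trivial ℤ G ℤ) where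
  complex := complex
  projective n := inferInstanceAs (Projective (freeRep ℤ G (rank n)))
  π := π
  quasiIso := quasiIso_π

/-- The homology of a complex of modules, at a spot with zero incoming differential. -/
lemma nonempty_homology_addEquiv_ker (K : CochainComplex (ModuleCat.{0} ℤ) ℕ) (n : ℕ)
    (h : K.d n (n + 1) = 0) :
    Nonempty (K.homology (n + 1) ≃+ LinearMap.ker (K.d (n + 1) (n + 2)).hom) := by
  have hi : (ComplexShape.up ℕ).prev (n + 1) = n := by simp
  have hj : (ComplexShape.up ℕ).next (n + 1) = n + 2 := by simp
  let S := K.sc' n (n + 1) (n + 2)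
  have : IsIso S.homologyπ := S.isIso_homologyπ h
  exact ⟨(K.homologyIsoSc' n (n + 1) (n + 2) hi hj ≪≫ (asIso S.homologyπ).symm ≪≫
    S.moduleCatCyclesIso).toLinearEquiv.toAddEquiv⟩

section TrivialCoefficients

variable {M : Type} [AddCommGroup M]

lemma hom_apply_eq_sum_of_trivial {r : ℕ} (f : freeRep ℤ G r ⟶ Rep.trivial ℤ G M)
    (x : Fin r → G → ℤ) : f.hom x = ∑ i, (∑ g, x i g) • f.hom (basis i) := by
  simp only [Finset.sum_smul]
  exact hom_apply_eq_sum f x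

lemma hom_dThree (f : freeRep ℤ G 2 ⟶ Rep.trivial ℤ G M) (x : Fin 1 → G → ℤ) :
    f.hom (dThree x) = 0 := by
  have h₀ : ∑ g, dThree x 0 g = 0 := by
    simp only [dThree_apply_zero, sum_eq, one_mul, mul_table]
    ring
  have h₁ : ∑ g, dThree x 1 g = 0 := by
    simp only [dThree_apply_one, sum_eq, one_mul, mul_table]
    ring
  rw [hom_apply_eq_sum_of_trivial, Fin.sum_univ_two, h₀, h₁, zero_smul, zero_smul, add_zero]

lemma hom_dFour (f : freeRep ℤ G 1 ⟶ Rep.trivial ℤ G M) (x : Fin 1 → G → ℤ) :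
    f.hom (dFour x) = (∑ g, x 0 g) • (6 : ℕ) • (f.hom (basis 0) : M) := by
  have h : ∑ g, dFour x 0 g = (∑ g, x 0 g) * (6 : ℕ) := by
    simp only [dFour_apply, Finset.sum_const, Finset.card_univ, Fintype.card_perm,
      Fintype.card_fin]
    rw [nsmul_eq_mul, mul_comm]
    rfl
  rw [hom_apply_eq_sum_of_trivial, Fin.sum_univ_one, h, mul_smul]
  exact congrArg _ (natCast_zsmul (G := M) _ _)

lemma dFour_comp_eq_zero_iff (f : freeRep ℤ G 1 ⟶ Rep.trivial ℤ G M) :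
    d 3 ≫ f = 0 ↔ (6 : ℕ) • (f.hom (basis 0) : M) = 0 := by
  constructor
  · intro h
    have := (hom_dFour f (basis 0)).symm.trans congr(Rep.Hom.hom $h (basis (0 : Fin 1)))
    simpa [basis] using this
  · intro h
    refine hom_ext_apply fun x => (hom_dFour f x).trans ?_
    rw [h, smul_zero]
    rfl

variable (M) in
/-- Equivariant maps from the free module of rank one are determined by their value at the
basis element. -/
noncomputable def homEquiv : (freeRep ℤ G 1 ⟶ Rep.trivial ℤ G M) ≃+ M where
  toFun f := f.hom (basis 0)
  invFun a := lift (A := Rep.trivial ℤ G M) fun _ => a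
  left_inv f := hom_ext_basis fun i => by
    rw [Subsingleton.elim i 0]
    exact lift_basis _ _
  right_inv _ := lift_basis (A := Rep.trivial ℤ G M) _ _
  map_add' _ _ := rfl

lemma mem_ker_iff (f : freeRep ℤ G 1 ⟶ Rep.trivial ℤ G M) :
    f ∈ LinearMap.ker ((complex.linearYonedaObj ℤ (Rep.trivial ℤ G M)).d 3 4).hom ↔
      homEquiv M f ∈ (nsmulAddMonoidHom 6 : M →+ M).ker := by
  rw [AddMonoidHom.mem_ker]
  refine Iff.trans ?_ (dFour_comp_eq_zero_iff f)
  rw [← complex_d]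
  rfl

variable (M) in
/-- The degree three cocycles are the `6`-torsion elements of the coefficients. -/
noncomputable def kerEquiv :
    LinearMap.ker ((complex.linearYonedaObj ℤ (Rep.trivial ℤ G M)).d 3 4).hom ≃+
      (nsmulAddMonoidHom 6 : M →+ M).ker where
  toFun f := ⟨homEquiv M f.1, (mem_ker_iff f.1).1 f.2⟩
  invFun a := ⟨(homEquiv M).symm a.1, (mem_ker_iff _).2 (by
    rw [AddEquiv.apply_symm_apply]
    exact a.2)⟩
  left_inv f := Subtype.ext ((homEquiv M).symm_apply_apply f.1)
  right_inv a := Subtype.ext ((homEquiv M).apply_symm_apply a.1)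
  map_add' _ _ := rfl

variable (M) in
lemma nonempty_groupCohomology_addEquiv :
    Nonempty (groupCohomology (Rep.trivial ℤ G M) 3 ≃+ (nsmulAddMonoidHom 6 : M →+ M).ker) := by
  have h : (complex.linearYonedaObj ℤ (Rep.trivial ℤ G M)).d 2 3 = 0 := by
    ext (f : freeRep ℤ G 2 ⟶ Rep.trivial ℤ G M)
    change complex.d 3 2 ≫ f = 0
    rw [complex_d]
    exact hom_ext_apply (hom_dThree f)
  obtain ⟨e⟩ := nonempty_homology_addEquiv_ker _ 2 h
  exact ⟨(groupCohomologyIso (Rep.trivial ℤ G M) 3 resolution).toLinearEquiv.toAddEquiv.trans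
    (e.trans (kerEquiv M))⟩

end TrivialCoefficients

lemma nonempty_ker_addEquiv_zmod (n : ℕ) [NeZero n] :
    Nonempty ((nsmulAddMonoidHom n : Additive ℂˣ →+ Additive ℂˣ).ker ≃+ ZMod n) := by
  let e : (nsmulAddMonoidHom n : Additive ℂˣ →+ Additive ℂˣ).ker ≃+
      Additive (rootsOfUnity n ℂ) :=
    { toFun x := .ofMul ⟨x.1.toMul, x.2⟩
      invFun x := ⟨.ofMul x.toMul.1, x.toMul.2⟩
      map_add' _ _ := rfl }
  have h : Nat.card (Additive (rootsOfUnity n ℂ)) = n := by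
    rw [Nat.card_congr Additive.toMul, Complex.card_rootsOfUnity]
  have e' := zmodAddCyclicAddEquiv (G := Additive (rootsOfUnity n ℂ)) inferInstance
  rw [h] at e'
  exact ⟨e.trans e'.symm⟩

end SymmetricThree

/-- `H³(S₃, ℂ*)` with trivial coefficients is cyclic of order 6. -/
theorem h3_s3_units_complex :
    Nonempty
      ((groupCohomology
          (Rep.trivial ℤ (Equiv.Perm (Fin 3)) (Additive ℂˣ)) 3) ≃+ ZMod 6) := by
  obtain ⟨e⟩ := SymmetricThree.nonempty_groupCohomology_addEquiv (Additive ℂˣ)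
  obtain ⟨e'⟩ := SymmetricThree.nonempty_ker_addEquiv_zmod 6
  exact ⟨e.trans e'⟩
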